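/- Let M be a countable structure in a countable relational language, let α ≥ 1 be a countable ordinal, let (Γ_i)_{i∈ω} be a countable list of Π_α-types none of which is Σ_α-supported in M, and let φ be a Π_{α+1} sentence of L_{ω₁ω} true in M. Then there is a countable structure N with N ≤_α M such that N ⊨ φ and N omits every Γ_i. -/

import Mathlib

open FirstOrder Language

namespace BFPaper

noncomputable section

/-! ## Countability of formulas in a countable relational language -/

instance formulaCountable (L : FirstOrder.Language.{0,0}) [L.IsRelational]
    [∀ n, Countable (L.Relations n)] (α : Type) [Countable α] :
    Countable (L.Formula α) := by
  have h1 : Countable (Σ n, L.BoundedFormula α n) :=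
    Function.Injective.countable BoundedFormula.listEncode_sigma_injective
  exact Function.Injective.countable
    (f := fun φ : L.Formula α => (⟨0, φ⟩ : Σ n, L.BoundedFormula α n))
    (fun a b h => by simpa using h)

/-- A fixed enumeration of the quantifier-free first-order formulas in the
variables `x_0, …, x_{n-1}`. -/
noncomputable def qfEnum (L : FirstOrder.Language.{0,0}) [L.IsRelational]
    [∀ n, Countable (L.Relations n)] (n : ℕ) : ℕ → L.Formula (Fin n) := fun k =>
  haveI : Nonempty {φ : L.Formula (Fin n) // φ.IsQF} :=
    ⟨⟨⊥, BoundedFormula.isQF_bot⟩⟩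
  (Classical.choose (exists_surjective_nat {φ : L.Formula (Fin n) // φ.IsQF}) k).1

/-! ## The standard asymmetric back-and-forth relations -/

/-- `bfLeq L α M N a b` is the standard asymmetric back-and-forth relation
`(M, ā) ≤_α (N, b̄)`. -/
noncomputable def bfLeq (L : FirstOrder.Language.{0,0}) [L.IsRelational]
    [∀ n, Countable (L.Relations n)] (α : Ordinal.{0}) (M N : Type)
    [L.Structure M] [L.Structure N] {n : ℕ} (a : Fin n → M) (b : Fin n → N) : Prop :=
  if α = 0 then
    ∀ k < n, ((qfEnum L n k).Realize a ↔ (qfEnum L n k).Realize b)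
  else
    ∀ β, ∀ _ : β < α, ∀ (m : ℕ) (d : Fin m → N), ∃ c : Fin m → M,
      bfLeq L β N M (Fin.append b d) (Fin.append a c)
termination_by α
decreasing_by assumption

/-- `M ≤_α N` for whole structures (empty tuples). -/
noncomputable def structLeq (L : FirstOrder.Language.{0,0}) [L.IsRelational]
    [∀ n, Countable (L.Relations n)] (α : Ordinal.{0}) (M N : Type)
    [L.Structure M] [L.Structure N] : Prop :=
  bfLeq L α M N Fin.elim0 Fin.elim0

/-! ## The space of countable `L`-structures -/

/-- The Polish space `Mod(L)` of `L`-structures with universe `ℕ` (for a relational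
language), presented as a product of discrete spaces. -/
abbrev ModSpace (L : FirstOrder.Language.{0,0}) : Type :=
  ∀ (n : ℕ), L.Relations n → (Fin n → ℕ) → Bool

/-- The underlying set (`ℕ`) of the structure coded by a point of `Mod(L)`. -/
def ModCarrier {L : FirstOrder.Language.{0,0}} (_x : ModSpace L) : Type := ℕ

instance {L : FirstOrder.Language.{0,0}} (x : ModSpace L) : Countable (ModCarrier x) :=
  inferInstanceAs (Countable ℕ)

noncomputable instance modCarrierStructure {L : FirstOrder.Language.{0,0}} [L.IsRelational]
    (x : ModSpace L) : L.Structure (ModCarrier x) where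
  funMap := fun {_} f => isEmptyElim f
  RelMap := fun {n} R v => x n R v = true

/-! ## The boldface Borel hierarchy and Wadge reducibility -/

/-- `A` is (boldface) `Σ⁰_α`: `Σ⁰₁` sets are the open sets, and for `α > 1` a `Σ⁰_α` set
is a countable union of sets each of which is `Π⁰_β` for some `1 ≤ β < α`. -/
def SigmaB (α : Ordinal.{0}) {X : Type} [TopologicalSpace X] (A : Set X) : Prop :=
  if α ≤ 1 then IsOpen A
  else ∃ f : ℕ → Set X, A = (⋃ i, f i) ∧
    ∀ i, ∃ β, 1 ≤ β ∧ ∃ _ : β < α, SigmaB β (f i)ᶜ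
termination_by α
decreasing_by assumption

/-- `A` is (boldface) `Π⁰_α`, i.e. the complement of `A` is `Σ⁰_α`. -/
def PiB (α : Ordinal.{0}) {X : Type} [TopologicalSpace X] (A : Set X) : Prop :=
  SigmaB α Aᶜ

/-- `A` is `Π⁰_α`-hard: every `Π⁰_α` subset of a zero-dimensional Polish space
continuously (Wadge) reduces to `A`. -/
def PiHard (α : Ordinal.{0}) {X : Type} [TopologicalSpace X] (A : Set X) : Prop :=
  ∀ (Y : Type) [TopologicalSpace Y] [PolishSpace Y] [TotallyDisconnectedSpace Y]
    (B : Set Y), PiB α B → ∃ g : Y → X, Continuous g ∧ ∀ y, y ∈ B ↔ g y ∈ A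

/-- `A` is `Π⁰_α`-complete. -/
def PiComplete (α : Ordinal.{0}) {X : Type} [TopologicalSpace X] (A : Set X) : Prop :=
  PiB α A ∧ PiHard α A

/-! ## Infinitary formulas of `L_{ω₁ω}` -/

/-- Formulas of `L_{ω₁ω}` (with countable conjunctions and disjunctions), with free
variables indexed by `ℕ`. -/
inductive LForm (L : FirstOrder.Language.{0,0}) : Type
  | rel (n : ℕ) (R : L.Relations n) (ts : Fin n → ℕ) : LForm L
  | equ (i j : ℕ) : LForm L
  | tru : LForm L
  | fls : LForm L
  | not (φ : LForm L) : LForm L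
  | conj (f : ℕ → LForm L) : LForm L
  | disj (f : ℕ → LForm L) : LForm L
  | all (k : ℕ) (φ : LForm L) : LForm L
  | ex (k : ℕ) (φ : LForm L) : LForm L

/-- Satisfaction of an `L_{ω₁ω}` formula in a structure `M` under a variable
assignment `v : ℕ → M`. -/
def Sat {L : FirstOrder.Language.{0,0}} (M : Type) [L.Structure M] : LForm L → (ℕ → M) → Prop
  | .rel _ R ts, v => Structure.RelMap R (fun i => v (ts i))
  | .equ i j, v => v i = v j
  | .tru, _ => True
  | .fls, _ => False
  | .not φ, v => ¬ Sat M φ v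
  | .conj f, v => ∀ i, Sat M (f i) v
  | .disj f, v => ∃ i, Sat M (f i) v
  | .all k φ, v => ∀ m : M, Sat M φ (Function.update v k m)
  | .ex k φ, v => ∃ m : M, Sat M φ (Function.update v k m)

/-- The free variables of an `L_{ω₁ω}` formula. -/
def fv {L : FirstOrder.Language.{0,0}} : LForm L → Set ℕ
  | .rel _ _ ts => Set.range ts
  | .equ i j => {i, j}
  | .tru => ∅
  | .fls => ∅
  | .not φ => fv φ
  | .conj f => ⋃ i, fv (f i)
  | .disj f => ⋃ i, fv (f i)
  | .all k φ => fv φ \ {k}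
  | .ex k φ => fv φ \ {k}

/-- Finitary quantifier-free `L_{ω₁ω}` formulas. -/
inductive IsQFinf {L : FirstOrder.Language.{0,0}} : LForm L → Prop
  | rel (n R ts) : IsQFinf (.rel n R ts)
  | equ (i j) : IsQFinf (.equ i j)
  | tru : IsQFinf .tru
  | fls : IsQFinf .fls
  | not {φ} : IsQFinf φ → IsQFinf (.not φ)
  | conj {f} : (Set.range f).Finite → (∀ i, IsQFinf (f i)) → IsQFinf (.conj f)
  | disj {f} : (Set.range f).Finite → (∀ i, IsQFinf (f i)) → IsQFinf (.disj f)

/-- `ExBlockOf φ ψ` : `φ` is `∃ x̄ ψ` for a (possibly empty) finite block of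
existential quantifiers. -/
inductive ExBlockOf {L : FirstOrder.Language.{0,0}} : LForm L → LForm L → Prop
  | refl (φ) : ExBlockOf φ φ
  | ex {φ ψ} (k) : ExBlockOf φ ψ → ExBlockOf (.ex k φ) ψ

/-- `AllBlockOf φ ψ` : `φ` is `∀ x̄ ψ` for a (possibly empty) finite block of
universal quantifiers. -/
inductive AllBlockOf {L : FirstOrder.Language.{0,0}} : LForm L → LForm L → Prop
  | refl (φ) : AllBlockOf φ φ
  | all {φ ψ} (k) : AllBlockOf φ ψ → AllBlockOf (.all k φ) ψ

/-- `IsSP α true φ` says `φ` is `Σ_α`; `IsSP α false φ` says `φ` is `Π_α`.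
`Σ₀ = Π₀` are the finitary quantifier-free formulas; for `α ≥ 1`, a `Σ_α` formula is a
countable disjunction of formulas `∃x̄ᵢ ψᵢ` with each `ψᵢ` in `Π_{βᵢ}` for some `βᵢ < α`,
and dually for `Π_α`. -/
def IsSP {L : FirstOrder.Language.{0,0}} (α : Ordinal.{0}) (isSigma : Bool) (φ : LForm L) : Prop :=
  if α = 0 then IsQFinf φ
  else if isSigma then
    ∃ f : ℕ → LForm L, φ = .disj f ∧
      ∀ i, ∃ ψ β, ∃ _ : β < α, ExBlockOf (f i) ψ ∧ IsSP β false ψ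
  else
    ∃ f : ℕ → LForm L, φ = .conj f ∧
      ∀ i, ∃ ψ β, ∃ _ : β < α, AllBlockOf (f i) ψ ∧ IsSP β true ψ
termination_by α
decreasing_by all_goals assumption

/-- `φ` is a `Σ_α` formula of `L_{ω₁ω}`. -/
def IsSigmaF {L : FirstOrder.Language.{0,0}} (α : Ordinal.{0}) (φ : LForm L) : Prop := IsSP α true φ

/-- `φ` is a `Π_α` formula of `L_{ω₁ω}`. -/
def IsPiF {L : FirstOrder.Language.{0,0}} (α : Ordinal.{0}) (φ : LForm L) : Prop := IsSP α false φ

/-! ## The back-and-forth classes `𝔈_α`, `𝔄_α`, `𝔈̄_α`, `𝔄̄_α` -/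

/-- Closure of a class of formulas under existential quantification and countable
disjunction. -/
inductive CloExDisj {L : FirstOrder.Language.{0,0}} (base : LForm L → Prop) : LForm L → Prop
  | base {φ} : base φ → CloExDisj base φ
  | ex {φ} (k) : CloExDisj base φ → CloExDisj base (.ex k φ)
  | disj {f} : (∀ i, CloExDisj base (f i)) → CloExDisj base (.disj f)

/-- Closure of a class of formulas under universal quantification and countable
conjunction. -/
inductive CloAllConj {L : FirstOrder.Language.{0,0}} (base : LForm L → Prop) : LForm L → Prop
  | base {φ} : base φ → CloAllConj base φ
  | all {φ} (k) : CloAllConj base φ → CloAllConj base (.all k φ)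
  | conj {f} : (∀ i, CloAllConj base (f i)) → CloAllConj base (.conj f)

/-- Closure of a class of formulas under countable conjunctions and disjunctions. -/
inductive CloConjDisj {L : FirstOrder.Language.{0,0}} (base : LForm L → Prop) : LForm L → Prop
  | base {φ} : base φ → CloConjDisj base φ
  | conj {f} : (∀ i, CloConjDisj base (f i)) → CloConjDisj base (.conj f)
  | disj {f} : (∀ i, CloConjDisj base (f i)) → CloConjDisj base (.disj f)

/-- `IsEA α true φ` says `φ ∈ 𝔈_α` and `IsEA α false φ` says `φ ∈ 𝔄_α`:
`𝔈₁ = Σ₁`, `𝔄₁ = Π₁`; for `α > 1`, `𝔈_α` is the closure of `⋃_{1 ≤ β < α} 𝔄̄_β` under `∃`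
and countable disjunction, where `𝔄̄_β` is the closure of `𝔄_β` under countable
conjunctions and disjunctions; dually for `𝔄_α`. -/
def IsEA {L : FirstOrder.Language.{0,0}} (α : Ordinal.{0}) (isE : Bool) (φ : LForm L) : Prop :=
  if α ≤ 1 then (if isE then IsSP 1 true φ else IsSP 1 false φ)
  else if isE then
    CloExDisj (fun ψ => ∃ β, 1 ≤ β ∧ ∃ _ : β < α,
      CloConjDisj (fun χ => IsEA β false χ) ψ) φ
  else
    CloAllConj (fun ψ => ∃ β, 1 ≤ β ∧ ∃ _ : β < α,
      CloConjDisj (fun χ => IsEA β true χ) ψ) φ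
termination_by α
decreasing_by all_goals assumption

/-- `φ ∈ 𝔈_α`. -/
def IsE {L : FirstOrder.Language.{0,0}} (α : Ordinal.{0}) (φ : LForm L) : Prop := IsEA α true φ

/-- `φ ∈ 𝔄_α`. -/
def IsA {L : FirstOrder.Language.{0,0}} (α : Ordinal.{0}) (φ : LForm L) : Prop := IsEA α false φ

/-- `φ ∈ 𝔈̄_α`, the closure of `𝔈_α` under countable conjunctions and disjunctions. -/
def IsEbar {L : FirstOrder.Language.{0,0}} (α : Ordinal.{0}) (φ : LForm L) : Prop :=
  CloConjDisj (IsE α) φ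

/-- `φ ∈ 𝔄̄_α`, the closure of `𝔄_α` under countable conjunctions and disjunctions. -/
def IsAbar {L : FirstOrder.Language.{0,0}} (α : Ordinal.{0}) (φ : LForm L) : Prop :=
  CloConjDisj (IsA α) φ

/-- `φ` is a `∀𝔈_α` formula: a countable conjunction of universally quantified `𝔈_α`
formulas. -/
def IsForallE {L : FirstOrder.Language.{0,0}} (α : Ordinal.{0}) (φ : LForm L) : Prop :=
  ∃ f : ℕ → LForm L, φ = .conj f ∧ ∀ i, ∃ ψ, AllBlockOf (f i) ψ ∧ IsE α ψ

/-- A sentence is a formula with no free variables. -/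
def IsSentence {L : FirstOrder.Language.{0,0}} (φ : LForm L) : Prop := fv φ = ∅

/-- Satisfaction of a formula (with free variables among `x_0, …, x_{n-1}`) by a tuple. -/
def SatTup {L : FirstOrder.Language.{0,0}} (M : Type) [L.Structure M] {n : ℕ}
    (c : Fin n → M) (φ : LForm L) : Prop :=
  ∀ v : ℕ → M, (∀ k : Fin n, v k = c k) → Sat M φ v

end

open Filter

section Formulas

variable {L : FirstOrder.Language.{0,0}}

theorem sat_congr {M : Type} [L.Structure M] (θ : LForm L) :
    ∀ {v w : ℕ → M}, (∀ x ∈ fv θ, v x = w x) → (Sat M θ v ↔ Sat M θ w) := by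
  induction θ with
  | rel n R ts =>
    intro v w h
    have : (fun i => v (ts i)) = fun i => w (ts i) :=
      funext fun i => h _ (Set.mem_range_self i)
    simp only [Sat, this]
  | equ i j =>
    intro v w h
    simp only [Sat, h i (Or.inl rfl), h j (Or.inr rfl)]
  | tru => exact fun _ => Iff.rfl
  | fls => exact fun _ => Iff.rfl
  | not φ ih => exact fun h => not_congr (ih h)
  | conj f ih =>
    exact fun h => forall_congr' fun i => ih i fun x hx => h x (Set.mem_iUnion.2 ⟨i, hx⟩)
  | disj f ih =>
    exact fun h => exists_congr fun i => ih i fun x hx => h x (Set.mem_iUnion.2 ⟨i, hx⟩)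
  | all k φ ih =>
    refine fun h => forall_congr' fun a => ih fun x hx => ?_
    by_cases hk : x = k
    · simp [hk]
    · simpa [Function.update_of_ne hk] using h x ⟨hx, hk⟩
  | ex k φ ih =>
    refine fun h => exists_congr fun a => ih fun x hx => ?_
    by_cases hk : x = k
    · simp [hk]
    · simpa [Function.update_of_ne hk] using h x ⟨hx, hk⟩

/-- The formal negation of a formula. -/
def formNeg : LForm L → LForm L
  | .rel n R ts => .not (.rel n R ts)
  | .equ i j => .not (.equ i j)
  | .tru => .fls
  | .fls => .tru
  | .not φ => φ
  | .conj f => .disj fun i => formNeg (f i)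
  | .disj f => .conj fun i => formNeg (f i)
  | .all k φ => .ex k (formNeg φ)
  | .ex k φ => .all k (formNeg φ)

theorem fv_formNeg (θ : LForm L) : fv (formNeg θ) = fv θ := by
  induction θ <;> simp_all [formNeg, fv]

theorem sat_formNeg {M : Type} [L.Structure M] (θ : LForm L) :
    ∀ v : ℕ → M, Sat M (formNeg θ) v ↔ ¬ Sat M θ v := by
  induction θ <;> simp_all [formNeg, Sat]

theorem IsQFinf.dual {θ : LForm L} (h : IsQFinf θ) : IsQFinf (formNeg θ) := by
  induction h with
  | rel n R ts => exact .not (.rel n R ts)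
  | equ i j => exact .not (.equ i j)
  | tru => exact .fls
  | fls => exact .tru
  | not h _ => exact h
  | conj hf _ ih =>
    exact .disj ((hf.image formNeg).subset (by rintro _ ⟨i, rfl⟩; exact ⟨_, ⟨i, rfl⟩, rfl⟩)) ih
  | disj hf _ ih =>
    exact .conj ((hf.image formNeg).subset (by rintro _ ⟨i, rfl⟩; exact ⟨_, ⟨i, rfl⟩, rfl⟩)) ih

theorem ExBlockOf.dual {χ ψ : LForm L} (h : ExBlockOf χ ψ) :
    AllBlockOf (formNeg χ) (formNeg ψ) := by
  induction h with
  | refl φ => exact .refl _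
  | ex k _ ih => exact .all k ih

theorem AllBlockOf.dual {χ ψ : LForm L} (h : AllBlockOf χ ψ) :
    ExBlockOf (formNeg χ) (formNeg ψ) := by
  induction h with
  | refl φ => exact .refl _
  | all k _ ih => exact .ex k ih

theorem isSP_zero {b : Bool} {θ : LForm L} : IsSP 0 b θ ↔ IsQFinf θ := by
  rw [IsSP, if_pos rfl]

theorem isSP_sigma {β : Ordinal.{0}} (hβ : β ≠ 0) {θ : LForm L} :
    IsSP β true θ ↔ ∃ f : ℕ → LForm L, θ = .disj f ∧
      ∀ i, ∃ ψ γ, ∃ _ : γ < β, ExBlockOf (f i) ψ ∧ IsSP γ false ψ := by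
  rw [IsSP, if_neg hβ, if_pos rfl]

theorem isSP_pi {β : Ordinal.{0}} (hβ : β ≠ 0) {θ : LForm L} :
    IsSP β false θ ↔ ∃ f : ℕ → LForm L, θ = .conj f ∧
      ∀ i, ∃ ψ γ, ∃ _ : γ < β, AllBlockOf (f i) ψ ∧ IsSP γ true ψ := by
  rw [IsSP, if_neg hβ, if_neg (by simp)]

theorem IsSP.dual {β : Ordinal.{0}} : ∀ {b : Bool} {θ : LForm L},
    IsSP β b θ → IsSP β (!b) (formNeg θ) := by
  induction β using WellFoundedLT.induction with
  | ind β ih =>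
    intro b θ h
    rcases eq_or_ne β 0 with rfl | hβ
    · exact isSP_zero.2 (isSP_zero.1 h).dual
    · cases b with
      | true =>
        obtain ⟨f, rfl, hf⟩ := (isSP_sigma hβ).1 h
        refine (isSP_pi hβ).2 ⟨_, rfl, fun i => ?_⟩
        obtain ⟨ψ, γ, hγ, hb, hψ⟩ := hf i
        exact ⟨_, γ, hγ, hb.dual, ih γ hγ hψ⟩
      | false =>
        obtain ⟨f, rfl, hf⟩ := (isSP_pi hβ).1 h
        refine (isSP_sigma hβ).2 ⟨_, rfl, fun i => ?_⟩
        obtain ⟨ψ, γ, hγ, hb, hψ⟩ := hf i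
        exact ⟨_, γ, hγ, hb.dual, ih γ hγ hψ⟩

/-- Every `Σ_β` formula is equivalent to a `Σ_α` formula when `β ≤ α` and `α ≠ 0`. -/
theorem IsSP.sigma_lift {α β : Ordinal.{0}} (hα : α ≠ 0) (hβα : β ≤ α) {θ : LForm L}
    (h : IsSP β true θ) : ∃ θ' : LForm L, IsSP α true θ' ∧
      ∀ (M : Type) [L.Structure M] (v : ℕ → M), Sat M θ' v ↔ Sat M θ v := by
  rcases eq_or_ne β 0 with rfl | hβ
  · refine ⟨.disj fun _ => θ, (isSP_sigma hα).2 ⟨_, rfl, fun _ =>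
      ⟨θ, 0, pos_iff_ne_zero.2 hα, .refl _, isSP_zero.2 (isSP_zero.1 h)⟩⟩, fun M _ v => ?_⟩
    simp [Sat]
  · obtain ⟨f, rfl, hf⟩ := (isSP_sigma hβ).1 h
    refine ⟨_, (isSP_sigma hα).2 ⟨f, rfl, fun i => ?_⟩, fun M _ v => Iff.rfl⟩
    obtain ⟨ψ, γ, hγ, hb, hψ⟩ := hf i
    exact ⟨ψ, γ, hγ.trans_le hβα, hb, hψ⟩

/-- A universal block quantifies over the values of a bounded set of variables. -/
theorem AllBlockOf.exists_vars {χ ψ : LForm L} (h : AllBlockOf χ ψ) :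
    ∃ (S : Set ℕ) (B : ℕ), (∀ x ∈ S, x < B) ∧ fv ψ ⊆ fv χ ∪ S ∧
      ∀ (M : Type) [L.Structure M] (v : ℕ → M),
        Sat M χ v ↔ ∀ w : ℕ → M, (∀ x ∉ S, w x = v x) → Sat M ψ w := by
  induction h with
  | refl φ =>
    refine ⟨∅, 0, by simp, by simp, fun M _ v => ⟨fun h w hw => ?_, fun h => h v fun _ _ => rfl⟩⟩
    rwa [show w = v from funext fun x => hw x (by simp)]
  | @all φ ψ k _ ih =>
    obtain ⟨S, B, hS, hfv, hsat⟩ := ih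
    refine ⟨insert k S, max B (k + 1), ?_, ?_, fun M _ v => ⟨fun h w hw => ?_, fun h a => ?_⟩⟩
    · rintro x (rfl | hx)
      · exact lt_max_of_lt_right (Nat.lt_succ_self _)
      · exact lt_max_of_lt_left (hS x hx)
    · intro x hx
      by_cases hk : x = k
      · exact Or.inr (Or.inl hk)
      · exact (hfv hx).imp (fun h => ⟨h, hk⟩) Or.inr
    · refine (hsat M _).1 (h (w k)) w fun x hx => ?_
      by_cases hk : x = k
      · simp [hk]
      · rw [Function.update_of_ne hk]
        exact hw x (by simp [hk, hx])
    · refine (hsat M _).2 fun w hw => h w fun x hx => ?_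
      simp only [Set.mem_insert_iff, not_or] at hx
      rw [hw x hx.2, Function.update_of_ne hx.1]

theorem ExBlockOf.exists_vars {χ ψ : LForm L} (h : ExBlockOf χ ψ) :
    ∃ (S : Set ℕ) (B : ℕ), (∀ x ∈ S, x < B) ∧
      ∀ (M : Type) [L.Structure M] (v : ℕ → M),
        Sat M χ v ↔ ∃ w : ℕ → M, (∀ x ∉ S, w x = v x) ∧ Sat M ψ w := by
  obtain ⟨S, B, hS, -, hsat⟩ := h.dual.exists_vars
  refine ⟨S, B, hS, fun M _ v => ?_⟩
  have := hsat M v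
  simp only [sat_formNeg] at this
  rw [← not_iff_not, this]
  push Not
  rfl

/-- The variables `n, …, n + l - 1` can be existentially quantified. -/
theorem exists_exBlock (l : ℕ) : ∀ (n : ℕ) (ψ : LForm L), fv ψ ⊆ Set.Iio (n + l) →
    ∃ χ, ExBlockOf χ ψ ∧ fv χ ⊆ Set.Iio n ∧
      ∀ (M : Type) [L.Structure M] (v : ℕ → M),
        Sat M χ v ↔ ∃ w : ℕ → M, (∀ x < n, w x = v x) ∧ Sat M ψ w := by
  induction l with
  | zero =>
    refine fun n ψ hψ => ⟨ψ, .refl _, hψ, fun M _ v => ⟨fun h => ⟨v, fun _ _ => rfl, h⟩, ?_⟩⟩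
    rintro ⟨w, hw, h⟩
    exact (sat_congr ψ fun x hx => hw x (hψ hx)).1 h
  | succ l ih =>
    intro n ψ hψ
    obtain ⟨χ, hb, hfv, hsat⟩ := ih (n + 1) ψ (by rwa [add_assoc, add_comm 1])
    refine ⟨.ex n χ, .ex n hb, ?_, fun M _ v => ⟨?_, ?_⟩⟩
    · rintro x ⟨hx, hn⟩
      exact lt_of_le_of_ne (Nat.lt_succ_iff.1 (hfv hx)) hn
    · rintro ⟨a, ha⟩
      obtain ⟨w, hw, h⟩ := (hsat M _).1 ha
      refine ⟨w, fun x hx => ?_, h⟩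
      rw [hw x (hx.trans (Nat.lt_succ_self n)), Function.update_of_ne hx.ne]
    · rintro ⟨w, hw, h⟩
      refine ⟨w n, (hsat M _).2 ⟨w, fun x hx => ?_, h⟩⟩
      rcases (Nat.lt_succ_iff.1 hx).eq_or_lt with rfl | hx
      · simp
      · rw [hw x hx, Function.update_of_ne hx.ne]

theorem exists_finite_conj {ι : Type*} [Finite ι] (n : ℕ) (θ : ι → LForm L)
    (hθ : ∀ i, IsQFinf (θ i)) (hfv : ∀ i, fv (θ i) ⊆ Set.Iio n) :
    ∃ χ : LForm L, IsQFinf χ ∧ fv χ ⊆ Set.Iio n ∧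
      ∀ (M : Type) [L.Structure M] (v : ℕ → M), Sat M χ v ↔ ∀ i, Sat M (θ i) v := by
  rcases isEmpty_or_nonempty ι with _ | _
  · exact ⟨.tru, .tru, by simp [fv], fun M _ v => by simp [Sat]⟩
  · obtain ⟨g, hg⟩ := exists_surjective_nat ι
    refine ⟨.conj (θ ∘ g), .conj ((Set.finite_range θ).subset (Set.range_comp_subset_range g θ))
      fun i => hθ _, Set.iUnion_subset fun i => hfv _, fun M _ v => ?_⟩
    simp only [Sat, Function.comp_apply]
    exact (hg.forall (p := fun i => Sat M (θ i) v)).symm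

end Formulas

section BackAndForth

variable {L : FirstOrder.Language.{0,0}} [∀ n, Countable (L.Relations n)]

/-- A fixed injective numbering of the relation symbols. -/
noncomputable def relRank (R : Σ n, L.Relations n) : ℕ :=
  (exists_injective_nat (Σ n, L.Relations n)).choose R

theorem relRank_injective : Function.Injective (relRank (L := L)) :=
  (exists_injective_nat (Σ n, L.Relations n)).choose_spec

variable {M N P : Type} [L.Structure M] [L.Structure N] [L.Structure P]

variable (L) in
/-- `v` and `w` agree on the atomic formulas in the first `n` variables that involve only
equality and the first `k` relation symbols. -/
def AtomicAgree (k n : ℕ) (v : ℕ → M) (w : ℕ → N) : Prop :=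
  (∀ i < n, ∀ j < n, v i = v j ↔ w i = w j) ∧
  ∀ R : Σ l, L.Relations l, relRank R < k → ∀ ts : Fin R.1 → ℕ, (∀ i, ts i < n) →
    (Structure.RelMap R.2 (v ∘ ts) ↔ Structure.RelMap R.2 (w ∘ ts))

theorem AtomicAgree.symm {k n : ℕ} {v : ℕ → M} {w : ℕ → N} (h : AtomicAgree L k n v w) :
    AtomicAgree L k n w v :=
  ⟨fun i hi j hj => (h.1 i hi j hj).symm, fun R hR ts hts => (h.2 R hR ts hts).symm⟩

theorem AtomicAgree.trans {k n : ℕ} {v : ℕ → M} {w : ℕ → N} {u : ℕ → P}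
    (h : AtomicAgree L k n v w) (h' : AtomicAgree L k n w u) : AtomicAgree L k n v u :=
  ⟨fun i hi j hj => (h.1 i hi j hj).trans (h'.1 i hi j hj),
    fun R hR ts hts => (h.2 R hR ts hts).trans (h'.2 R hR ts hts)⟩

theorem AtomicAgree.reindex {k k' n n' : ℕ} {v v' : ℕ → M} {w w' : ℕ → N}
    (h : AtomicAgree L k n v w) (hk : k' ≤ k) (f : ℕ → ℕ) (hf : ∀ i < n', f i < n)
    (hv : ∀ i < n', v' i = v (f i)) (hw : ∀ i < n', w' i = w (f i)) :
    AtomicAgree L k' n' v' w' := by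
  refine ⟨fun i hi j hj => ?_, fun R hR ts hts => ?_⟩
  · rw [hv i hi, hv j hj, hw i hi, hw j hj]
    exact h.1 _ (hf i hi) _ (hf j hj)
  · rw [show v' ∘ ts = v ∘ (f ∘ ts) from funext fun i => hv _ (hts i),
      show w' ∘ ts = w ∘ (f ∘ ts) from funext fun i => hw _ (hts i)]
    exact h.2 R (hR.trans_le hk) _ fun i => hf _ (hts i)

variable (L) in
/-- The back-and-forth relation on the first `n` values of two assignments, where level `0`
compares the finitely many atomic formulas selected by `k`. -/
def Bf (β : Ordinal.{0}) (M N : Type) [L.Structure M] [L.Structure N] (k n : ℕ)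
    (v : ℕ → M) (w : ℕ → N) : Prop :=
  if β = 0 then AtomicAgree L k n v w
  else ∀ γ, ∀ _ : γ < β, ∀ (k' n' : ℕ), n ≤ n' → ∀ w' : ℕ → N, (∀ i < n, w' i = w i) →
    ∃ v' : ℕ → M, (∀ i < n, v' i = v i) ∧ Bf γ N M k' n' w' v'
termination_by β
decreasing_by assumption

theorem bf_zero {k n : ℕ} {v : ℕ → M} {w : ℕ → N} :
    Bf L 0 M N k n v w ↔ AtomicAgree L k n v w := by
  rw [Bf, if_pos rfl]

theorem bf_iff {β : Ordinal.{0}} (hβ : β ≠ 0) {k n : ℕ} {v : ℕ → M} {w : ℕ → N} :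
    Bf L β M N k n v w ↔ ∀ γ < β, ∀ (k' n' : ℕ), n ≤ n' → ∀ w' : ℕ → N,
      (∀ i < n, w' i = w i) →
        ∃ v' : ℕ → M, (∀ i < n, v' i = v i) ∧ Bf L γ N M k' n' w' v' := by
  rw [Bf, if_neg hβ]

theorem Bf.refl (β : Ordinal.{0}) (k n : ℕ) : ∀ v : ℕ → M, Bf L β M M k n v v := by
  induction β using WellFoundedLT.induction generalizing k n with
  | ind β ih =>
    intro v
    rcases eq_or_ne β 0 with rfl | hβ
    · exact bf_zero.2 ⟨fun _ _ _ _ => Iff.rfl, fun _ _ _ _ => Iff.rfl⟩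
    · exact (bf_iff hβ).2 fun γ hγ k' n' _ w' hw' => ⟨w', hw', ih γ hγ k' n' w'⟩

theorem Bf.trans {β : Ordinal.{0}} : ∀ {M N P : Type} [L.Structure M] [L.Structure N]
    [L.Structure P] {k n : ℕ} {v : ℕ → M} {w : ℕ → N} {u : ℕ → P},
    Bf L β M N k n v w → Bf L β N P k n w u → Bf L β M P k n v u := by
  induction β using WellFoundedLT.induction with
  | ind β ih =>
    intro M N P _ _ _ k n v w u h h'
    rcases eq_or_ne β 0 with rfl | hβ
    · exact bf_zero.2 ((bf_zero.1 h).trans (bf_zero.1 h'))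
    · refine (bf_iff hβ).2 fun γ hγ k' n' hn u' hu' => ?_
      obtain ⟨w', hw', h₁⟩ := (bf_iff hβ).1 h' γ hγ k' n' hn u' hu'
      obtain ⟨v', hv', h₂⟩ := (bf_iff hβ).1 h γ hγ k' n' hn w' hw'
      exact ⟨v', hv', ih γ hγ h₁ h₂⟩

theorem Bf.reindex {β : Ordinal.{0}} : ∀ {M N : Type} [L.Structure M] [L.Structure N]
    {k k' n n' : ℕ} {v v' : ℕ → M} {w w' : ℕ → N},
    Bf L β M N k n v w → k' ≤ k → ∀ f : ℕ → ℕ, (∀ i < n', f i < n) →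
    (∀ i < n', v' i = v (f i)) → (∀ i < n', w' i = w (f i)) → Bf L β M N k' n' v' w' := by
  induction β using WellFoundedLT.induction with
  | ind β ih =>
    intro M N _ _ k k' n n' v v' w w' h hk f hf hv hw
    rcases eq_or_ne β 0 with rfl | hβ
    · exact bf_zero.2 ((bf_zero.1 h).reindex hk f hf hv hw)
    · refine (bf_iff hβ).2 fun γ hγ l m hm x hx => ?_
      obtain ⟨y, hy, hxy⟩ := (bf_iff hβ).1 h γ hγ l (n + m) (Nat.le_add_right _ _)
        (fun i => if i < n then w i else x (i - n)) fun i hi => if_pos hi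
      refine ⟨fun i => if i < n' then v' i else y (n + i), fun i hi => if_pos hi,
        ih γ hγ hxy le_rfl (fun i => if i < n' then f i else n + i) ?_ ?_ ?_⟩
      · intro i hi
        split_ifs with h'
        · exact (hf i h').trans_le (Nat.le_add_right _ _)
        · omega
      · intro i _
        by_cases h' : i < n'
        · rw [if_pos h', if_pos (hf i h'), hx i h', hw i h']
        · simp [h']
      · intro i _
        by_cases h' : i < n'
        · rw [if_pos h', if_pos h', hv i h', hy _ (hf i h')]
        · simp [h']

theorem Bf.restrict {β : Ordinal.{0}} {k k' n n' : ℕ} {v v' : ℕ → M} {w w' : ℕ → N}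
    (h : Bf L β M N k n v w) (hk : k' ≤ k) (hn : n' ≤ n)
    (hv : ∀ i < n', v' i = v i) (hw : ∀ i < n', w' i = w i) : Bf L β M N k' n' v' w' :=
  h.reindex hk id (fun _ hi => lt_of_lt_of_le hi hn) hv hw

/-- At a positive level, the relation yields the reversed relation at any smaller level. -/
theorem Bf.swap {β γ : Ordinal.{0}} {k n : ℕ} {v : ℕ → M} {w : ℕ → N}
    (h : Bf L β M N k n v w) (hγ : γ < β) (k' : ℕ) : Bf L γ N M k' n w v := by
  obtain ⟨v', hv', h'⟩ := (bf_iff (ne_bot_of_gt hγ)).1 h γ hγ k' n le_rfl w fun _ _ => rfl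
  exact h'.restrict le_rfl le_rfl (fun _ _ => rfl) fun i hi => (hv' i hi).symm

theorem Bf.mono {β γ : Ordinal.{0}} {k n : ℕ} {v : ℕ → M} {w : ℕ → N}
    (h : Bf L β M N k n v w) (hγ : γ ≤ β) : Bf L γ M N k n v w := by
  rcases eq_or_ne γ 0 with rfl | h0
  · rcases hγ.eq_or_lt with rfl | hγ
    · exact h
    · exact bf_zero.2 (bf_zero.1 (h.swap hγ k)).symm
  · exact (bf_iff h0).2 fun δ hδ => (bf_iff (h0.bot_lt.trans_le hγ).ne').1 h δ (hδ.trans_le hγ)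

theorem Bf.atomicAgree {β : Ordinal.{0}} {k n : ℕ} {v : ℕ → M} {w : ℕ → N}
    (h : Bf L β M N k n v w) : AtomicAgree L k n v w :=
  bf_zero.1 (h.mono (zero_le))

/-- Quantifier-free formulas are decided by finitely many relation symbols. -/
theorem IsQFinf.exists_rank {θ : LForm L} (hθ : IsQFinf θ) :
    ∃ K, ∀ (M N : Type) [L.Structure M] [L.Structure N] (k n : ℕ) (v : ℕ → M) (w : ℕ → N)
      (e : ℕ → ℕ), K ≤ k → (∀ x ∈ fv θ, e x < n) → AtomicAgree L k n v w →
        (Sat M θ (v ∘ e) ↔ Sat N θ (w ∘ e)) := by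
  have bound : ∀ (f : ℕ → LForm L), (Set.range f).Finite → (∀ i, ∃ K, ∀ (M N : Type)
      [L.Structure M] [L.Structure N] (k n : ℕ) (v : ℕ → M) (w : ℕ → N)
      (e : ℕ → ℕ), K ≤ k → (∀ x ∈ fv (f i), e x < n) → AtomicAgree L k n v w →
        (Sat M (f i) (v ∘ e) ↔ Sat N (f i) (w ∘ e))) → ∃ K, ∀ i, ∀ (M N : Type)
      [L.Structure M] [L.Structure N] (k n : ℕ) (v : ℕ → M) (w : ℕ → N)
      (e : ℕ → ℕ), K ≤ k → (∀ x ∈ fv (f i), e x < n) → AtomicAgree L k n v w →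
        (Sat M (f i) (v ∘ e) ↔ Sat N (f i) (w ∘ e)) := by
    intro f hf h
    have h' : ∀ θ ∈ Set.range f, ∃ K, ∀ (M N : Type) [L.Structure M] [L.Structure N] (k n : ℕ)
        (v : ℕ → M) (w : ℕ → N) (e : ℕ → ℕ), K ≤ k → (∀ x ∈ fv θ, e x < n) →
        AtomicAgree L k n v w → (Sat M θ (v ∘ e) ↔ Sat N θ (w ∘ e)) := by
      rintro _ ⟨i, rfl⟩
      exact h i
    choose! K hK using h'
    obtain ⟨B, hB⟩ := (hf.image K).bddAbove
    exact ⟨B, fun i M N _ _ k n v w e hk => hK (f i) ⟨i, rfl⟩ M N k n v w e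
      ((hB ⟨_, ⟨i, rfl⟩, rfl⟩).trans hk)⟩
  induction hθ with
  | rel n R ts =>
    exact ⟨relRank ⟨n, R⟩ + 1, fun M N _ _ k m v w e hk he h =>
      h.2 ⟨n, R⟩ hk (e ∘ ts) fun i => he _ ⟨i, rfl⟩⟩
  | equ i j =>
    exact ⟨0, fun M N _ _ k m v w e hk he h =>
      h.1 _ (he i (Or.inl rfl)) _ (he j (Or.inr rfl))⟩
  | tru => exact ⟨0, fun _ _ _ _ _ _ _ _ _ _ _ _ => Iff.rfl⟩
  | fls => exact ⟨0, fun _ _ _ _ _ _ _ _ _ _ _ _ => Iff.rfl⟩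
  | not _ ih =>
    obtain ⟨K, hK⟩ := ih
    exact ⟨K, fun M N _ _ k n v w e hk he h => not_congr (hK M N k n v w e hk he h)⟩
  | conj hf _ ih =>
    obtain ⟨K, hK⟩ := bound _ hf ih
    exact ⟨K, fun M N _ _ k n v w e hk he h => forall_congr' fun i =>
      hK i M N k n v w e hk (fun x hx => he x (Set.mem_iUnion.2 ⟨i, hx⟩)) h⟩
  | disj hf _ ih =>
    obtain ⟨K, hK⟩ := bound _ hf ih
    exact ⟨K, fun M N _ _ k n v w e hk he h => exists_congr fun i =>
      hK i M N k n v w e hk (fun x hx => he x (Set.mem_iUnion.2 ⟨i, hx⟩)) h⟩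

/-- `Π_β` formulas are preserved upwards along the back-and-forth relation. -/
theorem IsSP.exists_rank {β : Ordinal.{0}} : ∀ {θ : LForm L}, IsSP β false θ →
    ∃ K, ∀ (M N : Type) [L.Structure M] [L.Structure N] (k n : ℕ) (v : ℕ → M) (w : ℕ → N)
      (e : ℕ → ℕ), K ≤ k → (∀ x ∈ fv θ, e x < n) → Bf L β M N k n v w →
        Sat M θ (v ∘ e) → Sat N θ (w ∘ e) := by
  induction β using WellFoundedLT.induction with
  | ind β ih =>
    intro θ hθ
    rcases eq_or_ne β 0 with rfl | hβ
    · obtain ⟨K, hK⟩ := (isSP_zero.1 hθ).exists_rank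
      exact ⟨K, fun M N _ _ k n v w e hk he h => (hK M N k n v w e hk he (bf_zero.1 h)).1⟩
    obtain ⟨f, rfl, hf⟩ := (isSP_pi hβ).1 hθ
    refine ⟨0, fun M N _ _ k n v w e _ he h hsat i => ?_⟩
    obtain ⟨ψ, γ, hγ, hb, hψ⟩ := hf i
    obtain ⟨S, B, hS, hfv, hblock⟩ := hb.exists_vars
    obtain ⟨K, hK⟩ := ih γ hγ hψ.dual
    refine (hblock N _).2 fun w₁ hw₁ => ?_
    obtain ⟨v', hv', h'⟩ := (bf_iff hβ).1 h γ hγ K (n + B) (Nat.le_add_right _ _)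
      (fun i => if i < n then w i else w₁ (i - n)) fun i hi => if_pos hi
    classical
    set w' : ℕ → N := fun i => if i < n then w i else w₁ (i - n) with hw'
    set e' : ℕ → ℕ := fun x => if x ∈ S then n + x else e x with he'
    have hen : ∀ x ∈ fv ψ, x ∉ S → e x < n := fun x hx hxS =>
      he x (Set.mem_iUnion.2 ⟨i, (hfv hx).resolve_right hxS⟩)
    have hlt : ∀ x ∈ fv (formNeg ψ), e' x < n + B := by
      intro x hx
      rw [fv_formNeg] at hx
      simp only [he']
      split_ifs with hxS
      · exact Nat.add_lt_add_left (hS x hxS) n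
      · exact (hen x hx hxS).trans_le (Nat.le_add_right _ _)
    have hN : Sat N ψ w₁ ↔ Sat N ψ (w' ∘ e') := by
      refine sat_congr ψ fun x hx => ?_
      by_cases hxS : x ∈ S
      · simp [hw', he', hxS]
      · simp [hw', he', hxS, hen x hx hxS, hw₁ x hxS]
    have hM : Sat M ψ (v' ∘ e') := by
      refine (sat_congr ψ fun x hx => ?_).1 ((hblock M _).1 (hsat i)
        (fun x => if x ∈ S then v' (n + x) else v (e x)) fun x hx => if_neg hx)
      by_cases hxS : x ∈ S
      · simp [he', hxS]
      · simp [he', hxS, hv' _ (hen x hx hxS)]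
    rw [hN]
    by_contra hcon
    exact (sat_formNeg ψ _).1 (hK N M K (n + B) w' v' e' le_rfl hlt h' ((sat_formNeg ψ _).2 hcon)) hM

end BackAndForth

section FirstOrderFormulas

variable {L : FirstOrder.Language.{0,0}} [L.IsRelational]

theorem exists_term_realize_eq {n : ℕ} (t : L.Term (Fin n ⊕ Fin 0)) :
    ∃ i : Fin n, ∀ (M : Type) [L.Structure M] (v : Fin n → M) (xs : Fin 0 → M),
      t.realize (Sum.elim v xs) = v i := by
  cases t with
  | var x =>
    rcases x with i | i
    · exact ⟨i, fun M _ v xs => rfl⟩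
    · exact i.elim0
  | func f _ => exact isEmptyElim f

variable [∀ n, Countable (L.Relations n)]

theorem isQF_exists_rank {n : ℕ} {θ : L.BoundedFormula (Fin n) 0} (hθ : θ.IsQF) :
    ∃ K, ∀ k, K ≤ k → ∀ (M N : Type) [L.Structure M] [L.Structure N] (v : ℕ → M) (w : ℕ → N)
      (xs : Fin 0 → M) (ys : Fin 0 → N), AtomicAgree L k n v w →
        (θ.Realize (fun i => v i) xs ↔ θ.Realize (fun i => w i) ys) := by
  induction hθ with
  | falsum => exact ⟨0, fun _ _ _ _ _ _ _ _ _ _ _ => Iff.rfl⟩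
  | of_isAtomic h =>
    cases h with
    | equal t₁ t₂ =>
      obtain ⟨i, hi⟩ := exists_term_realize_eq t₁
      obtain ⟨j, hj⟩ := exists_term_realize_eq t₂
      refine ⟨0, fun k _ M N _ _ v w xs ys h => ?_⟩
      rw [BoundedFormula.realize_bdEqual, BoundedFormula.realize_bdEqual, hi, hi, hj, hj]
      exact h.1 i i.2 j j.2
    | rel R ts =>
      choose g hg using fun i => exists_term_realize_eq (ts i)
      refine ⟨relRank ⟨_, R⟩ + 1, fun k hk M N _ _ v w xs ys h => ?_⟩
      rw [BoundedFormula.realize_rel, BoundedFormula.realize_rel]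
      simp only [hg]
      exact h.2 ⟨_, R⟩ hk (fun i => g i) fun i => (g i).2
  | imp _ _ ih₁ ih₂ =>
    obtain ⟨K₁, h₁⟩ := ih₁
    obtain ⟨K₂, h₂⟩ := ih₂
    refine ⟨max K₁ K₂, fun k hk M N _ _ v w xs ys h => ?_⟩
    rw [BoundedFormula.realize_imp, BoundedFormula.realize_imp,
      h₁ k ((le_max_left _ _).trans hk) M N v w xs ys h,
      h₂ k ((le_max_right _ _).trans hk) M N v w xs ys h]

theorem qfEnum_isQF (n k : ℕ) : (qfEnum L n k).IsQF :=
  Subtype.property _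

theorem exists_rank_qfEnum (n : ℕ) : ∃ K, ∀ (M N : Type) [L.Structure M] [L.Structure N]
    (v : ℕ → M) (w : ℕ → N), AtomicAgree L K n v w → ∀ j < n,
      ((qfEnum L n j).Realize (fun i => v i) ↔ (qfEnum L n j).Realize (fun i => w i)) := by
  choose K hK using fun j => isQF_exists_rank (qfEnum_isQF (L := L) n j)
  exact ⟨(Finset.range n).sup K, fun M N _ _ v w h j hj =>
    hK j _ (Finset.le_sup (Finset.mem_range.2 hj)) M N v w _ _ h⟩

/-- The back-and-forth relation on assignments refines the one on tuples. -/
theorem exists_rank_bfLeq : ∃ K : ℕ → ℕ, ∀ (β : Ordinal.{0}) (M N : Type) [L.Structure M]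
    [L.Structure N] (n : ℕ) (v : ℕ → M) (w : ℕ → N), Bf L β M N (K n) n v w →
      bfLeq L β M N (fun i : Fin n => v i) (fun i : Fin n => w i) := by
  choose K hK using exists_rank_qfEnum (L := L)
  refine ⟨K, fun β => ?_⟩
  induction β using WellFoundedLT.induction with
  | ind β ih =>
    intro M N _ _ n v w h
    rw [bfLeq]
    split_ifs with hβ
    · subst hβ
      exact hK n M N v w (bf_zero.1 h)
    · intro γ hγ m d
      obtain ⟨v', hv', h'⟩ := (bf_iff hβ).1 h γ hγ (K (n + m)) (n + m) (Nat.le_add_right _ _)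
        (fun i => if hi : i < n + m then Fin.append (fun i : Fin n => w i) d ⟨i, hi⟩ else w i)
        (fun i hi => by
          rw [dif_pos (hi.trans_le (Nat.le_add_right _ _))]
          exact Fin.append_left _ d ⟨i, hi⟩)
      refine ⟨fun i => v' (n + i), ?_⟩
      convert ih γ hγ N M (n + m) _ v' h' using 1
      · funext i
        simp
      · funext i
        refine Fin.addCases (fun i => ?_) (fun i => ?_) i
        · simp [hv']
        · simp

end FirstOrderFormulas

section Definability

variable {L : FirstOrder.Language.{0,0}} [∀ n, Countable (L.Relations n)]
  {M : Type} [L.Structure M]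

/-- The assignment listing the entries of `b`, continued by a constant. -/
def asg [Inhabited M] (b : List M) (i : ℕ) : M := b.getD i default

theorem exists_asg_eq [Inhabited M] (v : ℕ → M) (n : ℕ) : ∃ b, ∀ i < n, asg b i = v i :=
  ⟨(List.range n).map v, fun i hi => by simp [asg, hi]⟩

theorem asg_lt (b : List ℕ) : ∃ B, ∀ i, asg b i < B := by
  refine ⟨b.sum + 1, fun i => Nat.lt_succ_of_le ?_⟩
  by_cases hi : i < b.length
  · simpa [asg, hi] using List.le_sum_of_mem (List.getElem_mem hi)
  · simp [asg, hi]

theorem exists_qf_def (k n : ℕ) (a : ℕ → M) : ∃ χ : LForm L, IsQFinf χ ∧ fv χ ⊆ Set.Iio n ∧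
    ∀ v : ℕ → M, Sat M χ v ↔ AtomicAgree L k n a v := by
  classical
  have : Finite {R : Σ l, L.Relations l // relRank R < k} :=
    Finite.of_injective (fun R => (⟨relRank R.1, R.2⟩ : Fin k)) fun R R' h =>
      Subtype.ext (relRank_injective (Fin.mk.inj_iff.1 h))
  let at' : (Fin n × Fin n) ⊕ (Σ R : {R : Σ l, L.Relations l // relRank R < k},
      Fin R.1.1 → Fin n) → LForm L :=
    Sum.elim (fun p => .equ p.1 p.2) (fun p => .rel p.1.1.1 p.1.1.2 fun i => p.2 i)
  let lit := fun p => if Sat M (at' p) a then at' p else formNeg (at' p)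
  have hat : ∀ p, IsQFinf (at' p) := by
    rintro (p | p)
    · exact .equ _ _
    · exact .rel _ _ _
  have hfv : ∀ p, fv (at' p) ⊆ Set.Iio n := by
    rintro (p | p) x hx
    · rcases hx with rfl | rfl
      exacts [p.1.2, p.2.2]
    · obtain ⟨i, rfl⟩ := hx
      exact (p.2 i).2
  have hlit : ∀ p v, Sat M (lit p) v ↔ (Sat M (at' p) a ↔ Sat M (at' p) v) := by
    intro p v
    by_cases h : Sat M (at' p) a <;> simp [lit, h, sat_formNeg]
  obtain ⟨χ, hχ, hχfv, hsat⟩ := exists_finite_conj n lit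
    (fun p => by
      simp only [lit]
      split_ifs
      exacts [hat p, (hat p).dual])
    (fun p => by
      simp only [lit]
      split_ifs
      exacts [hfv p, (fv_formNeg _).trans_subset (hfv p)])
  refine ⟨χ, hχ, hχfv, fun v => ?_⟩
  rw [hsat]
  simp only [hlit]
  constructor
  · exact fun h => ⟨fun i hi j hj => h (.inl (⟨i, hi⟩, ⟨j, hj⟩)),
      fun R hR ts hts => h (.inr ⟨⟨R, hR⟩, fun i => ⟨ts i, hts i⟩⟩)⟩
  · rintro h (p | p)
    · exact h.1 _ p.1.2 _ p.2.2
    · exact h.2 _ p.1.2 _ fun i => (p.2 i).2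

/-- In a countable structure, the upward closure of a tuple under the back-and-forth relation of
level `β` is defined by a `Π_β` formula. -/
theorem exists_pi_def [Countable M] [Nonempty M] {β : Ordinal.{0}} :
    Countable (Set.Iio β) → ∀ (k n : ℕ) (a : ℕ → M), ∃ χ : LForm L, IsSP β false χ ∧
      fv χ ⊆ Set.Iio n ∧ ∀ v : ℕ → M, Sat M χ v ↔ Bf L β M M k n a v := by
  have : Inhabited M := Classical.inhabited_of_nonempty ‹_›
  induction β using WellFoundedLT.induction with
  | ind β ih =>
    intro hc k n a
    rcases eq_or_ne β 0 with rfl | hβ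
    · obtain ⟨χ, hχ, hfv, hsat⟩ := exists_qf_def (L := L) k n a
      exact ⟨χ, isSP_zero.2 hχ, hfv, fun v => (hsat v).trans bf_zero.symm⟩
    let J := Set.Iio β × ℕ × ℕ × List M
    have : Nonempty J := ⟨⟨0, hβ.bot_lt⟩, 0, 0, []⟩
    obtain ⟨g, hg⟩ := exists_surjective_nat J
    have key : ∀ p : J, ∃ χ : LForm L, (∃ ψ γ, ∃ _ : γ < β, AllBlockOf χ ψ ∧ IsSP γ true ψ) ∧
        fv χ ⊆ Set.Iio n ∧ ∀ v : ℕ → M, Sat M χ v ↔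
          ((∀ a' : ℕ → M, (∀ i < n, a' i = a i) →
            ¬ Bf L p.1 M M p.2.1 (n + p.2.2.1) (asg p.2.2.2) a') →
          ∀ v' : ℕ → M, (∀ i < n, v' i = v i) →
            ¬ Bf L p.1 M M p.2.1 (n + p.2.2.1) (asg p.2.2.2) v') := by
      rintro ⟨⟨γ, hγ⟩, k', l, b⟩
      have hγ' : γ < β := hγ
      by_cases h : ∀ a' : ℕ → M, (∀ i < n, a' i = a i) → ¬ Bf L γ M M k' (n + l) (asg b) a'
      · obtain ⟨ψ, hψ, hψfv, hψsat⟩ :=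
          ih γ hγ' ((Set.countable_coe_iff.1 hc).mono (Set.Iio_subset_Iio hγ'.le)).to_subtype k' (n + l) (asg b)
        obtain ⟨χ, hb, hfv, hsat⟩ := exists_exBlock l n ψ hψfv
        refine ⟨formNeg χ, ⟨_, γ, hγ', hb.dual, hψ.dual⟩, (fv_formNeg χ).trans_subset hfv,
          fun v => ?_⟩
        rw [sat_formNeg, hsat]
        simp only [hψsat, not_exists, not_and]
        exact ⟨fun h' _ => h', fun h' => h' h⟩
      · exact ⟨.tru, ⟨.tru, 0, hβ.bot_lt, .refl _, isSP_zero.2 .tru⟩, by simp [fv],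
          fun v => ⟨fun _ h' => (h h').elim, fun _ => trivial⟩⟩
    choose F hF hFfv hFsat using key
    refine ⟨.conj (F ∘ g), (isSP_pi hβ).2 ⟨_, rfl, fun i => hF _⟩,
      Set.iUnion_subset fun i => hFfv _, fun v => ?_⟩
    have : Sat M (.conj (F ∘ g)) v ↔ ∀ p, Sat M (F p) v :=
      (hg.forall (p := fun p => Sat M (F p) v)).symm
    rw [this]
    simp only [hFsat]
    constructor
    · intro h
      refine (bf_iff hβ).2 fun γ hγ k' n' hn w hw => ?_
      by_contra! hcon
      obtain ⟨l, rfl⟩ := Nat.exists_eq_add_of_le hn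
      obtain ⟨b, hb⟩ := exists_asg_eq w (n + l)
      refine h (⟨γ, hγ⟩, k', l, b) (fun a' ha' hbf => hcon a' ha' ?_) w hw ?_
      · exact hbf.restrict le_rfl le_rfl (fun i hi => (hb i hi).symm) fun _ _ => rfl
      · exact (Bf.refl γ k' (n + l) w).restrict le_rfl le_rfl hb fun _ _ => rfl
    · rintro h ⟨⟨γ, hγ⟩, k', l, b⟩ hp v' hv' hbf
      obtain ⟨a', ha', h'⟩ := (bf_iff hβ).1 h γ hγ k' (n + l) (Nat.le_add_right _ _) v' hv'
      exact hp a' ha' (hbf.trans h')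

end Definability

section Conditions

/-- A forcing condition: an assignment in `M`, of which the first `len` values are constrained up
to the back-and-forth relation of level `lvl < α`. -/
structure Cond (L : FirstOrder.Language.{0,0}) (M : Type) (α : Ordinal.{0}) : Type 1 where
  len : ℕ
  rank : ℕ
  lvl : Ordinal.{0}
  lvl_lt : lvl < α
  val : ℕ → M

variable {L : FirstOrder.Language.{0,0}} [∀ n, Countable (L.Relations n)]
  {M : Type} [L.Structure M] {α : Ordinal.{0}}

instance : Preorder (Cond L M α) where
  le p q := p.len ≤ q.len ∧ p.rank ≤ q.rank ∧ p.lvl ≤ q.lvl ∧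
    Bf L p.lvl M M p.rank p.len p.val q.val
  le_refl p := ⟨le_rfl, le_rfl, le_rfl, .refl _ _ _ _⟩
  le_trans p q r h h' := ⟨h.1.trans h'.1, h.2.1.trans h'.2.1, h.2.2.1.trans h'.2.2.1,
    h.2.2.2.trans ((h'.2.2.2.mono h.2.2.1).restrict h.2.1 h.1 (fun _ _ => rfl) fun _ _ => rfl)⟩

theorem Cond.le_of_eqOn {p q : Cond L M α} (h₁ : p.len ≤ q.len) (h₂ : p.rank ≤ q.rank)
    (h₃ : p.lvl ≤ q.lvl) (h : ∀ i < p.len, q.val i = p.val i) : p ≤ q :=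
  ⟨h₁, h₂, h₃, (Bf.refl _ _ _ p.val).restrict le_rfl le_rfl (fun _ _ => rfl) h⟩

theorem Cond.exists_ge (p : Cond L M α) (n k : ℕ) {β : Ordinal.{0}} (hβ : β < α) :
    ∃ q, p ≤ q ∧ n ≤ q.len ∧ k ≤ q.rank ∧ β ≤ q.lvl ∧ q.val = p.val :=
  ⟨⟨max p.len n, max p.rank k, max p.lvl β, max_lt p.lvl_lt hβ, p.val⟩,
    Cond.le_of_eqOn (le_max_left _ _) (le_max_left _ _) (le_max_left _ _) fun _ _ => rfl,
    le_max_right _ _, le_max_right _ _, le_max_right _ _, rfl⟩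

/-- The condition `p` guarantees that `θ` holds at the values of the indices `e`. -/
def Forces (p : Cond L M α) (θ : LForm L) (e : ℕ → ℕ) : Prop :=
  ∀ (N : Type) [L.Structure N] (w : ℕ → N), Bf L p.lvl M N p.rank p.len p.val w →
    Sat N θ (w ∘ e)

theorem exists_forces_of_sat (hα : α ≠ 0) {θ : LForm L} (hθ : IsSP α true θ)
    (p : Cond L M α) {e : ℕ → ℕ} {B : ℕ} (he : ∀ i, e i < B) (h : Sat M θ (p.val ∘ e)) :
    ∃ q, p ≤ q ∧ Forces q θ e := by
  classical
  obtain ⟨f, rfl, hf⟩ := (isSP_sigma hα).1 hθ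
  obtain ⟨j, hj⟩ := h
  obtain ⟨ψ, β, hβ, hb, hψ⟩ := hf j
  obtain ⟨S, C, hS, hblock⟩ := hb.exists_vars
  obtain ⟨v₁, hv₁, hsat⟩ := (hblock M _).1 hj
  obtain ⟨K, hK⟩ := hψ.exists_rank
  obtain ⟨q, hpq, hqn, hqk, hqβ, hqv⟩ := p.exists_ge B K hβ
  let u : ℕ → M := fun x => if x < q.len then q.val x else v₁ (x - q.len)
  let e' : ℕ → ℕ := fun x => if x ∈ S then q.len + x else e x
  have he' : ∀ x, e' x < q.len + C := by
    intro x
    by_cases hx : x ∈ S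
    · simpa [e', hx] using hS x hx
    · simpa [e', hx] using ((he x).trans_le hqn).trans_le (Nat.le_add_right _ _)
  have hu : u ∘ e' = v₁ := by
    funext x
    by_cases hx : x ∈ S
    · simp [u, e', hx]
    · simp [u, e', hx, (he x).trans_le hqn, hqv, hv₁ x hx]
  refine ⟨⟨q.len + C, q.rank, q.lvl, q.lvl_lt, u⟩, hpq.trans (Cond.le_of_eqOn
    (Nat.le_add_right _ _) le_rfl le_rfl fun i hi => if_pos hi), fun N _ w hw => ⟨j, ?_⟩⟩
  refine (hblock N _).2 ⟨w ∘ e', fun x hx => by simp [e', hx], ?_⟩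
  exact hK M N q.rank _ u w e' hqk (fun x _ => he' x) (hw.mono hqβ) (by rwa [hu])

/-- An unsupported type is falsified by some extension of any given condition. -/
theorem exists_forces_of_unsupported [Countable M] [Nonempty M] (hα : α ≠ 0)
    (hc : Countable (Set.Iio α)) {m : ℕ} {Γ : Set (LForm L)}
    (hΓ : ∀ ψ ∈ Γ, IsPiF α ψ ∧ fv ψ ⊆ Set.Iio m)
    (hunsupp : ¬ ∃ σ : LForm L, IsSigmaF α σ ∧ fv σ ⊆ Set.Iio m ∧
      (∃ c : Fin m → M, SatTup M c σ) ∧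
      ∀ c : Fin m → M, SatTup M c σ → ∀ ψ ∈ Γ, SatTup M c ψ)
    (p : Cond L M α) {e : ℕ → ℕ} {B : ℕ} (he : ∀ i, e i < B) :
    ∃ q, p ≤ q ∧ ∃ ψ ∈ Γ, Forces q (formNeg ψ) e := by
  obtain ⟨q, hpq, hqn, -, -, -⟩ := p.exists_ge B 0 p.lvl_lt
  let b : ℕ → M := fun x => if x < m then q.val (e x) else q.val (x - m)
  obtain ⟨χ, hχ, hχfv, hχsat⟩ := exists_pi_def (L := L)
    ((Set.countable_coe_iff.1 hc).mono (Set.Iio_subset_Iio q.lvl_lt.le)).to_subtype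
    q.rank (m + q.len) b
  obtain ⟨σ, hσb, hσfv, hσsat⟩ := exists_exBlock q.len m χ hχfv
  have hsup : IsSigmaF α (.disj fun _ => σ) :=
    (isSP_sigma hα).2 ⟨_, rfl, fun _ => ⟨χ, q.lvl, q.lvl_lt, hσb, hχ⟩⟩
  have hsat : ∀ v : ℕ → M, Sat M (.disj fun _ => σ) v ↔
      ∃ w : ℕ → M, (∀ x < m, w x = v x) ∧ Bf L q.lvl M M q.rank (m + q.len) b w := by
    intro v
    simp only [Sat, exists_const, hσsat, hχsat]
  have hnot : ∃ c : Fin m → M, SatTup M c (.disj fun _ => σ) ∧ ∃ ψ ∈ Γ, ¬ SatTup M c ψ := by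
    by_contra! hcon
    refine hunsupp ⟨_, hsup, Set.iUnion_subset fun _ => hσfv, ⟨fun i => b i, fun v hv => ?_⟩,
      hcon⟩
    exact (hsat v).2 ⟨b, fun x hx => (hv ⟨x, hx⟩).symm, .refl _ _ _ _⟩
  obtain ⟨c, hcσ, ψ, hψ, hcψ⟩ := hnot
  simp only [SatTup, not_forall] at hcψ
  obtain ⟨v, hv, hvψ⟩ := hcψ
  obtain ⟨w, hw, hbw⟩ := (hsat v).1 (hcσ v hv)
  let u : ℕ → M := fun x => w (m + x)
  have hqu : Bf L q.lvl M M q.rank q.len q.val u :=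
    hbw.reindex le_rfl (fun x => m + x) (fun i hi => Nat.add_lt_add_left hi m)
      (fun i _ => by simp [b]) fun i _ => rfl
  have hue : ∀ x < m, u (e x) = v x := by
    intro x hx
    rw [← hw x hx]
    refine ((hbw.atomicAgree.1 (m + e x) ?_ x ?_).1 ?_)
    · exact Nat.add_lt_add_left ((he x).trans_le hqn) m
    · omega
    · simp [b, hx]
  obtain ⟨r, hr, hforce⟩ := exists_forces_of_sat hα (hΓ ψ hψ).1.dual
    (⟨q.len, q.rank, q.lvl, q.lvl_lt, u⟩ : Cond L M α) he
    ((sat_formNeg ψ _).2 fun h => hvψ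
      ((sat_congr ψ fun x hx => hue x ((hΓ ψ hψ).2 hx)).1 h))
  have hqr : q ≤ r := le_trans (b := (⟨q.len, q.rank, q.lvl, q.lvl_lt, u⟩ : Cond L M α))
    ⟨le_rfl, le_rfl, le_rfl, hqu⟩ hr
  exact ⟨r, hpq.trans hqr, ψ, hψ, hforce⟩

/-- The condition `p` admits a tuple above `a` that extends the values of the first `m` of the
indices `e`. -/
def HasWitness (p : Cond L M α) (δ : Ordinal.{0}) (k n m : ℕ) (a : ℕ → M) (e : ℕ → ℕ) : Prop :=
  ∃ c : ℕ → M, (∀ i < m, c i = p.val (e i)) ∧ Bf L δ M M k n a c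

/-- The condition `p` names a tuple above `a` by indices extending the first `m` of the
indices `e`. -/
def NamesWitness (p : Cond L M α) (δ : Ordinal.{0}) (k n m : ℕ) (a : ℕ → M) (e : ℕ → ℕ) :
    Prop :=
  ∃ e' : ℕ → ℕ, (∀ i < m, e' i = e i) ∧
    ∀ w : ℕ → M, Bf L p.lvl M M p.rank p.len p.val w → Bf L δ M M k n a (w ∘ e')

theorem HasWitness.exists_names {p : Cond L M α} {δ : Ordinal.{0}} (hδ : δ < α) {k n m : ℕ}
    {a : ℕ → M} {e : ℕ → ℕ} {B : ℕ} (he : ∀ i, e i < B) (h : HasWitness p δ k n m a e) :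
    ∃ q, p ≤ q ∧ NamesWitness q δ k n m a e := by
  obtain ⟨c, hc, hac⟩ := h
  obtain ⟨q, hpq, hqn, hqk, hqδ, hqv⟩ := p.exists_ge B k hδ
  let u : ℕ → M := fun x => if x < q.len then q.val x else c (x - q.len)
  let e' : ℕ → ℕ := fun x => if x < m then e x else q.len + x
  have hu : ∀ x, u (e' x) = c x := by
    intro x
    by_cases hx : x < m
    · simp [u, e', hx, (he x).trans_le hqn, hqv, hc x hx]
    · simp [u, e', hx]
  refine ⟨⟨q.len + n, q.rank, q.lvl, q.lvl_lt, u⟩, hpq.trans (Cond.le_of_eqOn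
    (Nat.le_add_right _ _) le_rfl le_rfl fun i hi => if_pos hi), e', fun i hi => if_pos hi,
    fun w hw => hac.trans ?_⟩
  refine (hw.mono hqδ).reindex hqk e' (fun i hi => ?_) (fun i _ => (hu i).symm) fun i _ => rfl
  by_cases hx : i < m
  · simpa [e', hx] using ((he i).trans_le hqn).trans_le (Nat.le_add_right _ _)
  · simpa [e', hx] using hi

end Conditions

section Limit

variable {M : Type}

/-- Indices are identified when their values eventually coincide. -/
def limSetoid (v : ℕ → ℕ → M) : Setoid ℕ where
  r i j := ∀ᶠ t in atTop, v t i = v t j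
  iseqv := ⟨fun _ => .of_forall fun _ => rfl, fun h => h.mono fun _ => Eq.symm,
    fun h h' => (h.and h').mono fun _ h => h.1.trans h.2⟩

/-- The universe of the limit of a sequence of assignments. -/
def Lim (v : ℕ → ℕ → M) : Type := Quotient (limSetoid v)

/-- The element of the limit named by an index. -/
def Lim.mk (v : ℕ → ℕ → M) (i : ℕ) : Lim v := Quotient.mk (limSetoid v) i

instance (v : ℕ → ℕ → M) : Countable (Lim v) :=
  inferInstanceAs (Countable (Quotient (limSetoid v)))

theorem Lim.mk_eq_mk {v : ℕ → ℕ → M} {i j : ℕ} :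
    Lim.mk v i = Lim.mk v j ↔ ∀ᶠ t in atTop, v t i = v t j :=
  Quotient.eq (r := limSetoid v)

theorem Lim.mk_surjective (v : ℕ → ℕ → M) : Function.Surjective (Lim.mk v) :=
  Quotient.mk_surjective

theorem Lim.exists_comp_eq {v : ℕ → ℕ → M} {ι : Type*} (w : ι → Lim v) :
    ∃ e : ι → ℕ, Lim.mk v ∘ e = w :=
  (Lim.mk_surjective v).comp_left w

variable {L : FirstOrder.Language.{0,0}} [L.IsRelational] [L.Structure M]

instance (v : ℕ → ℕ → M) : L.Structure (Lim v) where
  funMap f := isEmptyElim f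
  RelMap R x := ∀ᶠ t in atTop, Structure.RelMap R (v t ∘ Function.surjInv (Lim.mk_surjective v) ∘ x)

theorem Lim.relMap_iff {v : ℕ → ℕ → M} {n : ℕ} (R : L.Relations n) (e : Fin n → ℕ) :
    Structure.RelMap R (Lim.mk v ∘ e) ↔ ∀ᶠ t in atTop, Structure.RelMap R (v t ∘ e) := by
  refine eventually_congr ?_
  have h : ∀ i, ∀ᶠ t in atTop, v t (Function.surjInv (Lim.mk_surjective v) (Lim.mk v (e i))) =
      v t (e i) := fun i => Lim.mk_eq_mk.1 (Function.surjInv_eq _ _)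
  filter_upwards [eventually_all.2 h] with t ht
  rw [show v t ∘ Function.surjInv (Lim.mk_surjective v) ∘ Lim.mk v ∘ e = v t ∘ e from funext ht]

end Limit

section Generic

variable {L : FirstOrder.Language.{0,0}} [∀ n, Countable (L.Relations n)]
  {M : Type} [L.Structure M] [Inhabited M] {α : Ordinal.{0}}

/-- A sequence of conditions that is sufficiently generic for its limit to lie below `M`. -/
structure IsGeneric (p : ℕ → Cond L M α) : Prop where
  monotone : Monotone p
  large : ∀ n k, ∀ β < α, ∃ s, n ≤ (p s).len ∧ k ≤ (p s).rank ∧ β ≤ (p s).lvl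
  witness : ∀ δ < α, ∀ (k n m : ℕ) (a : List M) (e : List ℕ), ∃ s,
    NamesWitness (p s) δ k n m (asg a) (asg e) ∨
      ∀ r, p s ≤ r → ¬ HasWitness r δ k n m (asg a) (asg e)

/-- Countably many dense requirements can be met by a generic sequence. -/
theorem exists_isGeneric [Countable M] (hα : α ≠ 0) (hc : Countable (Set.Iio α)) {ι : Type}
    [Countable ι] (D : ι → Order.Cofinal (Cond L M α)) :
    ∃ p : ℕ → Cond L M α, IsGeneric p ∧ ∀ i, ∃ s, p s ∈ D i := by
  let J := ((ℕ × ℕ × Set.Iio α) ⊕ (Set.Iio α × ℕ × ℕ × ℕ × List M × List ℕ)) ⊕ ι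
  have : Encodable J := Encodable.ofCountable J
  let E : J → Order.Cofinal (Cond L M α) := Sum.elim (Sum.elim
    (fun x => ⟨{q | x.1 ≤ q.len ∧ x.2.1 ≤ q.rank ∧ x.2.2.1 ≤ q.lvl}, fun p => by
      obtain ⟨q, hpq, h₁, h₂, h₃, -⟩ := p.exists_ge x.1 x.2.1 x.2.2.2
      exact ⟨q, ⟨h₁, h₂, h₃⟩, hpq⟩⟩)
    (fun x => ⟨{q | NamesWitness q x.1 x.2.1 x.2.2.1 x.2.2.2.1 (asg x.2.2.2.2.1)
        (asg x.2.2.2.2.2) ∨ ∀ r, q ≤ r → ¬ HasWitness r x.1 x.2.1 x.2.2.1 x.2.2.2.1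
        (asg x.2.2.2.2.1) (asg x.2.2.2.2.2)}, fun p => by
      by_cases h : ∃ r, p ≤ r ∧ HasWitness r x.1 x.2.1 x.2.2.1 x.2.2.2.1
        (asg x.2.2.2.2.1) (asg x.2.2.2.2.2)
      · obtain ⟨r, hpr, hr⟩ := h
        obtain ⟨B, hB⟩ := asg_lt x.2.2.2.2.2
        obtain ⟨q, hrq, hq⟩ := hr.exists_names x.1.2 hB
        exact ⟨q, Or.inl hq, hpr.trans hrq⟩
      · exact ⟨p, Or.inr fun r hr hw => h ⟨r, hr, hw⟩, le_rfl⟩⟩)) D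
  let p := Order.sequenceOfCofinals (⟨0, 0, 0, hα.bot_lt, default⟩ : Cond L M α) E
  have hp : ∀ j, ∃ s, p s ∈ E j := fun j => ⟨_, Order.sequenceOfCofinals.encode_mem _ E j⟩
  exact ⟨p, ⟨Order.sequenceOfCofinals.monotone _ E,
    fun n k β hβ => hp (.inl (.inl (n, k, ⟨β, hβ⟩))),
    fun δ hδ k n m a e => hp (.inl (.inr (⟨δ, hδ⟩, k, n, m, a, e)))⟩, fun i => hp (.inr i)⟩

theorem IsGeneric.exists_large {p : ℕ → Cond L M α} (hp : IsGeneric p) (n k : ℕ)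
    {β : Ordinal.{0}} (hβ : β < α) (e : ℕ → ℕ) :
    ∃ s, (∀ i < n, e i < (p s).len) ∧ k ≤ (p s).rank ∧ β ≤ (p s).lvl := by
  obtain ⟨s, h₁, h₂, h₃⟩ := hp.large ((Finset.range n).sup e + 1) k β hβ
  exact ⟨s, fun i hi => (Nat.lt_succ_of_le (Finset.le_sup (Finset.mem_range.2 hi))).trans_le h₁,
    h₂, h₃⟩

variable [L.IsRelational]

/-- The limit of a sequence of conditions. -/
abbrev condLim (p : ℕ → Cond L M α) : Type := Lim fun t => (p t).val

/-- The element of the limit named by an index. -/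
abbrev condMk (p : ℕ → Cond L M α) : ℕ → condLim p := Lim.mk fun t => (p t).val

namespace IsGeneric

variable {p : ℕ → Cond L M α}

theorem eventually_atomicAgree (hp : IsGeneric p) (hα : α ≠ 0) (k n : ℕ) (e : ℕ → ℕ) :
    ∀ᶠ t in atTop, AtomicAgree L k n (condMk p ∘ e) ((p t).val ∘ e) := by
  obtain ⟨s, hn, hk, -⟩ := hp.exists_large n k hα.bot_lt e
  have hst : ∀ t ≥ s, AtomicAgree L k n ((p s).val ∘ e) ((p t).val ∘ e) := fun t ht =>
    (hp.monotone ht).2.2.2.atomicAgree.reindex hk e hn (fun _ _ => rfl) fun _ _ => rfl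
  refine (eventually_ge_atTop s).mono fun t ht => ?_
  have eventually_iff : ∀ {Q : ℕ → Prop}, (∀ t ≥ s, Q s ↔ Q t) → ((∀ᶠ t in atTop, Q t) ↔ Q t) := by
    intro Q hQ
    rw [← hQ t ht]
    refine ⟨fun h => ?_, fun h => (eventually_ge_atTop s).mono fun t ht => (hQ t ht).1 h⟩
    obtain ⟨t', h', ht'⟩ := (h.and (eventually_ge_atTop s)).exists
    exact (hQ t' ht').2 h'
  refine ⟨fun i hi j hj => ?_, fun R hR ts hts => ?_⟩
  · exact Lim.mk_eq_mk.trans (eventually_iff fun t ht => (hst t ht).1 i hi j hj)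
  · exact (Lim.relMap_iff R.2 (e ∘ ts)).trans (eventually_iff fun t ht => (hst t ht).2 R hR ts hts)

theorem bf_lim_aux (hp : IsGeneric p) (β : Ordinal.{0}) :
    (β < α → ∀ (k n : ℕ) (a : ℕ → M) (e : ℕ → ℕ),
      (∀ᶠ t in atTop, Bf L β M M k n a ((p t).val ∘ e)) →
        Bf L β M (condLim p) k n a (condMk p ∘ e)) ∧
    (β ≤ α → α ≠ 0 → ∀ (k n : ℕ) (a : ℕ → M) (e : ℕ → ℕ),
      (∀ᶠ t in atTop, Bf L β M M k n ((p t).val ∘ e) a) →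
        Bf L β (condLim p) M k n (condMk p ∘ e) a) := by
  induction β using WellFoundedLT.induction with
  | ind β ih =>
    rcases eq_or_ne β 0 with rfl | hβ
    · refine ⟨fun hα k n a e h => ?_, fun _ hα k n a e h => ?_⟩
      · obtain ⟨t, ht, ht'⟩ := (h.and (hp.eventually_atomicAgree hα.ne' k n e)).exists
        exact bf_zero.2 (ht.atomicAgree.trans ht'.symm)
      · obtain ⟨t, ht, ht'⟩ := (h.and (hp.eventually_atomicAgree hα k n e)).exists
        exact bf_zero.2 (ht'.trans ht.atomicAgree)
    refine ⟨fun hβα k n a e h => (bf_iff hβ).2 fun γ hγ k' n' hn w' hw' => ?_,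
      fun hβα hα k n a e h => (bf_iff hβ).2 fun γ hγ k' n' hn a' ha' => ?_⟩
    · obtain ⟨f, rfl⟩ := Lim.exists_comp_eq w'
      let e' : ℕ → ℕ := fun i => if i < n then e i else f i
      have he' : ∀ i, condMk p (f i) = condMk p (e' i) := by
        intro i
        by_cases hi : i < n
        · simpa [e', hi] using hw' i hi
        · simp [e', hi]
      obtain ⟨s, hs, hsk, hsβ⟩ := hp.exists_large n' k' hβα e'
      obtain ⟨t, ht, hst⟩ := (h.and (eventually_ge_atTop s)).exists
      obtain ⟨a', ha', hb⟩ := (bf_iff hβ).1 ht γ hγ k' n' hn ((p t).val ∘ e')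
        fun i hi => by simp [e', hi]
      refine ⟨a', ha', ?_⟩
      refine ((ih γ hγ).2 (hγ.trans hβα).le ((zero_le).trans_lt hβα).ne' k' n' a' e' ?_).restrict
        le_rfl le_rfl (fun i _ => he' i) fun _ _ => rfl
      refine (eventually_ge_atTop t).mono fun r hr => ?_
      have hsl := hp.monotone hst
      exact (((hp.monotone hr).2.2.2.swap (hγ.trans_le (hsβ.trans hsl.2.2.1)) k').reindex le_rfl e'
        (fun i hi => (hs i hi).trans_le hsl.1) (fun _ _ => rfl) fun _ _ => rfl).trans hb
    · obtain ⟨b, hb⟩ := exists_asg_eq a' n'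
      obtain ⟨l, hl⟩ := exists_asg_eq e n
      obtain ⟨s, hs⟩ := hp.witness γ (hγ.trans_le hβα) k' n' n b l
      rcases hs with ⟨e', he', hb'⟩ | hs
      · refine ⟨condMk p ∘ e', fun i hi => by simp [he' i hi, hl i hi], ?_⟩
        refine ((ih γ hγ).1 (hγ.trans_le hβα) k' n' (asg b) e' ?_).restrict le_rfl le_rfl
          (fun i hi => (hb i hi).symm) fun _ _ => rfl
        exact (eventually_ge_atTop s).mono fun t ht => hb' _ (hp.monotone ht).2.2.2
      · obtain ⟨t, ht, hst⟩ := (h.and (eventually_ge_atTop s)).exists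
        obtain ⟨c, hc, hac⟩ := (bf_iff hβ).1 ht γ hγ k' n' hn a' ha'
        exact (hs _ (hp.monotone hst) ⟨c, fun i hi => by simp [hc i hi, hl i hi],
          hac.restrict le_rfl le_rfl hb fun _ _ => rfl⟩).elim

/-- The limit of a generic sequence meets the constraints of its conditions. -/
theorem bf_lim (hp : IsGeneric p) (t : ℕ) :
    Bf L (p t).lvl M (condLim p) (p t).rank (p t).len (p t).val (condMk p) :=
  (hp.bf_lim_aux _).1 (p t).lvl_lt _ _ _ id
    ((eventually_ge_atTop t).mono fun _ hr => (hp.monotone hr).2.2.2)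

theorem sat_of_forces (hp : IsGeneric p) {t : ℕ} {θ : LForm L} {e : ℕ → ℕ}
    (h : Forces (p t) θ e) : Sat (condLim p) θ (condMk p ∘ e) :=
  h _ _ (hp.bf_lim t)

theorem structLeq_lim (hp : IsGeneric p) (hα : α ≠ 0) : structLeq L α (condLim p) M := by
  obtain ⟨K, hK⟩ := exists_rank_bfLeq (L := L)
  have h := hK α (condLim p) M 0 (condMk p ∘ id) default ((hp.bf_lim_aux α).2 le_rfl hα _ _ _ _
    (.of_forall fun t => (Bf.refl α (K 0) 0 (p t).val).restrict le_rfl le_rfl (by simp) (by simp)))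
  rw [structLeq]
  convert h using 1

end IsGeneric

end Generic

section Assembly

variable {L : FirstOrder.Language.{0,0}} {M : Type} [L.Structure M] {α : Ordinal.{0}}

theorem countable_Iio_of_card_le (hc : α.card ≤ Cardinal.aleph0) : Countable (Set.Iio α) := by
  rw [← Cardinal.mk_le_aleph0_iff, Cardinal.mk_Iio_ordinal]
  rwa [Cardinal.lift_le_aleph0]

/-- An unsupported type is omitted in the empty structure. -/
theorem not_satTup_of_isEmpty [IsEmpty M] (hα : α ≠ 0) {m : ℕ} {Γ : Set (LForm L)}
    (hunsupp : ¬ ∃ σ : LForm L, IsSigmaF α σ ∧ fv σ ⊆ Set.Iio m ∧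
      (∃ c : Fin m → M, SatTup M c σ) ∧
      ∀ c : Fin m → M, SatTup M c σ → ∀ ψ ∈ Γ, SatTup M c ψ)
    (c : Fin m → M) : ¬ ∀ ψ ∈ Γ, SatTup M c ψ := fun _ =>
  hunsupp ⟨.disj fun _ => .tru, (isSP_sigma hα).2 ⟨_, rfl, fun _ =>
    ⟨.tru, 0, hα.bot_lt, .refl _, isSP_zero.2 .tru⟩⟩, by simp [fv],
    ⟨c, fun v => isEmptyElim (v 0)⟩, fun _ _ _ _ v => isEmptyElim (v 0)⟩

variable [L.IsRelational] [∀ n, Countable (L.Relations n)]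

theorem bfLeq_refl (α : Ordinal.{0}) {n : ℕ} (a : Fin n → M) : bfLeq L α M M a a := by
  induction α using WellFoundedLT.induction generalizing n with
  | ind α ih =>
    rw [bfLeq]
    split_ifs
    · exact fun _ _ => Iff.rfl
    · exact fun β hβ k d => ⟨d, ih β hβ _⟩

/-- The instances of a `Π_{α+1}` sentence true in `M` can be forced one at a time. -/
theorem exists_cofinal_of_sentence [Inhabited M] (hα : α ≠ 0) {φ : LForm L}
    (hφ : IsPiF (α + 1) φ) (hsent : IsSentence φ) (hM : ∀ v : ℕ → M, Sat M φ v) :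
    ∃ D : ℕ × List ℕ → Order.Cofinal (Cond L M α), ∀ p : ℕ → Cond L M α, IsGeneric p →
      (∀ x, ∃ s, p s ∈ D x) → ∀ v, Sat (condLim p) φ v := by
  obtain ⟨f, rfl, hf⟩ := (isSP_pi (by simp)).1 hφ
  choose ψ β hβ hb hψ using hf
  choose S B hS hfv hblock using fun i => (hb i).exists_vars
  choose θ hθ hsat using fun i => (hψ i).sigma_lift hα (Order.lt_succ_iff.1 (hβ i))
  refine ⟨fun x => ⟨{q | Forces q (θ x.1) (asg x.2)}, fun p => ?_⟩, fun p hp hD v i => ?_⟩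
  · obtain ⟨C, hC⟩ := asg_lt x.2
    obtain ⟨q, hpq, hq⟩ := exists_forces_of_sat hα (hθ x.1) p hC
      ((hsat x.1 _ _).2 ((hblock x.1 M _).1 (hM (p.val ∘ asg x.2) x.1) _ fun _ _ => rfl))
    exact ⟨q, hq, hpq⟩
  · refine (hblock i _ v).2 fun w _ => ?_
    obtain ⟨e, rfl⟩ := Lim.exists_comp_eq w
    obtain ⟨l, hl⟩ := exists_asg_eq e (B i)
    obtain ⟨s, hs⟩ := hD (i, l)
    refine (sat_congr (ψ i) fun x hx => ?_).1 ((hsat i _ _).1 (hp.sat_of_forces hs))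
    have hx' : x ∈ S i := (hfv i hx).resolve_left fun h => by
      have : x ∈ fv (LForm.conj f) := Set.mem_iUnion.2 ⟨i, h⟩
      rw [hsent] at this
      exact this
    simp [hl x (hS i x hx')]

/-- Each tuple of the limit can be forced to omit an unsupported type. -/
theorem exists_cofinal_of_unsupported [Countable M] [Inhabited M] (hα : α ≠ 0)
    (hc : Countable (Set.Iio α)) {m : ℕ} {Γ : Set (LForm L)}
    (hΓ : ∀ ψ ∈ Γ, IsPiF α ψ ∧ fv ψ ⊆ Set.Iio m)
    (hunsupp : ¬ ∃ σ : LForm L, IsSigmaF α σ ∧ fv σ ⊆ Set.Iio m ∧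
      (∃ c : Fin m → M, SatTup M c σ) ∧
      ∀ c : Fin m → M, SatTup M c σ → ∀ ψ ∈ Γ, SatTup M c ψ) :
    ∃ D : List ℕ → Order.Cofinal (Cond L M α), ∀ p : ℕ → Cond L M α, IsGeneric p →
      (∀ x, ∃ s, p s ∈ D x) → ∀ c : Fin m → condLim p, ¬ ∀ ψ ∈ Γ, SatTup (condLim p) c ψ := by
  refine ⟨fun l => ⟨{q | ∃ ψ ∈ Γ, Forces q (formNeg ψ) (asg l)}, fun p => ?_⟩,
    fun p hp hD c h => ?_⟩
  · obtain ⟨C, hC⟩ := asg_lt l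
    obtain ⟨q, hpq, hq⟩ := exists_forces_of_unsupported hα hc hΓ hunsupp p hC
    exact ⟨q, hq, hpq⟩
  · obtain ⟨e, rfl⟩ := Lim.exists_comp_eq c
    obtain ⟨l, hl⟩ := exists_asg_eq (fun i => if hi : i < m then e ⟨i, hi⟩ else 0) m
    obtain ⟨s, ψ, hψ, hs⟩ := hD l
    refine (sat_formNeg ψ _).1 (hp.sat_of_forces hs) (h ψ hψ _ fun i => ?_)
    simp [hl i i.2]

end Assembly

/-- Type-omitting: if `(Γ_i)_{i ∈ ω}` is a list of `Π_α`-types none of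
which is `Σ_α`-supported in the countable structure `M`, and `φ` is a `Π_{α+1}` sentence true
in `M`, then there is a countable structure `N ≤_α M` with `N ⊨ φ` omitting every `Γ_i`. -/
theorem statement18 (L : FirstOrder.Language.{0,0}) [L.IsRelational]
    [∀ n, Countable (L.Relations n)]
    (M : Type) [L.Structure M] [Countable M]
    (α : Ordinal.{0}) (hα : 1 ≤ α) (hc : α.card ≤ Cardinal.aleph0)
    (m : ℕ → ℕ) (Γ : ℕ → Set (LForm L))
    (hΓPi : ∀ i, ∀ ψ ∈ Γ i, IsPiF α ψ ∧ fv ψ ⊆ Set.Iio (m i))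
    (hΓunsupp : ∀ i, ¬ ∃ σ : LForm L, IsSigmaF α σ ∧ fv σ ⊆ Set.Iio (m i) ∧
      (∃ c : Fin (m i) → M, SatTup M c σ) ∧
      ∀ c : Fin (m i) → M, SatTup M c σ → ∀ ψ ∈ Γ i, SatTup M c ψ)
    (φ : LForm L) (hφ : IsPiF (α + 1) φ) (hsent : IsSentence φ)
    (hMφ : ∀ v : ℕ → M, Sat M φ v) :
    ∃ (N : Type) (iN : L.Structure N) (_ : Countable N),
      haveI := iN
      structLeq L α N M ∧ (∀ v : ℕ → N, Sat N φ v) ∧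
      ∀ (i : ℕ) (c : Fin (m i) → N), ¬ ∀ ψ ∈ Γ i, SatTup N c ψ := by
  have hα0 : α ≠ 0 := (zero_lt_one.trans_le hα).ne'
  rcases isEmpty_or_nonempty M with hM | ⟨⟨x⟩⟩
  · exact ⟨M, inferInstance, inferInstance, bfLeq_refl α _, hMφ, fun i c =>
      not_satTup_of_isEmpty hα0 (hΓunsupp i) c⟩
  let _ : Inhabited M := ⟨x⟩
  have hcα := countable_Iio_of_card_le hc
  obtain ⟨D, hD⟩ := exists_cofinal_of_sentence hα0 hφ hsent hMφ
  choose E hE using fun i => exists_cofinal_of_unsupported hα0 hcα (hΓPi i) (hΓunsupp i)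
  obtain ⟨p, hp, hmem⟩ := exists_isGeneric hα0 hcα
    (Sum.elim D fun y : ℕ × List ℕ => E y.1 y.2)
  exact ⟨condLim p, inferInstance, inferInstance, hp.structLeq_lim hα0,
    hD p hp fun y => hmem (.inl y), fun i => hE i p hp fun l => hmem (.inr (i, l))⟩

end BFPaper
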